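/- arXiv:1504.02357 — 4 statements merged into one kernel-verified Lean document; each statement's English description precedes it below -/
import Mathlib

section
/- Let C be a linear [n,k] code over F_q with generator matrix G, and let m be a positive integer with m ≤ k. Then γ(C) = m if and only if m is the smallest positive integer for which there exists a (k−m)-dimensional linear subspace U of F_q^k containing none of the n column vectors of G. -/
/-- The Hamming weight of a vector. -/
def wt {F : Type*} [Field F] [DecidableEq F] {n : ℕ} (x : Fin n → F) : ℕ :=
  (Finset.univ.filter fun i => x i ≠ 0).card

/-- A subcode `D` of `F^n` has full support: `Supp(D) = E = {1,…,n}`. -/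
def HasFullSupport {F : Type*} [Field F] {n : ℕ} (D : Submodule F (Fin n → F)) : Prop :=
  ∀ i : Fin n, ∃ x ∈ D, x i ≠ 0

/-- The set of positive integers `r` such that `C` has an `r`-dimensional subcode of full
support; the covering dimension `γ(C)` is the least element of this set. -/
def gammaSet {F : Type*} [Field F] {n : ℕ} (C : Submodule F (Fin n → F)) : Set ℕ :=
  {r | 0 < r ∧ ∃ D : Submodule F (Fin n → F), D ≤ C ∧ Module.finrank F D = r ∧
    HasFullSupport D}

/-- The set of Hamming weights of nonzero codewords of the dual code `C⊥`;
the minimum dual distance `d(C⊥)` is the least element of this set. -/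
def dualWeights {F : Type*} [Field F] [DecidableEq F] {n : ℕ}
    (C : Submodule F (Fin n → F)) : Set ℕ :=
  {w | ∃ y : Fin n → F, y ≠ 0 ∧ (∀ x ∈ C, ∑ i, x i * y i = 0) ∧ wt y = w}

/-- The image of `W` under `x ↦ x ᵥ* G` has full support if and only if the orthogonal complement
of `W` for the dot product contains no column of `G`. -/
theorem hasFullSupport_map_vecMulLinear_iff {F : Type*} [Field F] {n k : ℕ}
    (G : Matrix (Fin k) (Fin n) F) (W : Submodule F (Fin k → F)) :
    HasFullSupport (W.map G.vecMulLinear) ↔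
      ∀ j : Fin n, (fun i => G i j) ∉
        LinearMap.BilinForm.orthogonal (Matrix.toBilin' (1 : Matrix (Fin k) (Fin k) F)) W := by
  refine forall_congr' fun j => ?_
  simp only [LinearMap.BilinForm.mem_orthogonal_iff, Matrix.toBilin'_apply', Matrix.one_mulVec,
    Submodule.mem_map, exists_exists_and_eq_and, not_forall, exists_prop]
  rfl

theorem mem_gammaSet_iff_exists_finrank_eq_sub {F : Type*} [Field F] {n k r : ℕ}
    (G : Matrix (Fin k) (Fin n) F) (hG : LinearIndependent F G) (hrk : r ≤ k) :
    r ∈ gammaSet (Submodule.span F (Set.range G)) ↔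
      0 < r ∧ ∃ U : Submodule F (Fin k → F),
        Module.finrank F U = k - r ∧ ∀ j : Fin n, (fun i => G i j) ∉ U := by
  have hinj : Function.Injective G.vecMulLinear := Matrix.vecMul_injective_iff.mpr hG
  have hrange : LinearMap.range G.vecMulLinear = Submodule.span F (Set.range G) :=
    range_vecMulLinear G
  have hB : (Matrix.toBilin' (1 : Matrix (Fin k) (Fin k) F)).Nondegenerate :=
    LinearMap.BilinForm.nondegenerate_toBilin'_of_det_ne_zero' _ (by simp)
  have hrefl : (Matrix.toBilin' (1 : Matrix (Fin k) (Fin k) F)).IsRefl := fun x y h => by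
    rw [Matrix.toBilin'_apply', Matrix.one_mulVec] at h ⊢
    rwa [dotProduct_comm]
  refine and_congr_right fun _ => ⟨?_, ?_⟩
  · rintro ⟨D, hDC, hDr, hD⟩
    obtain ⟨W, rfl⟩ : ∃ W : Submodule F (Fin k → F), W.map G.vecMulLinear = D :=
      ⟨D.comap G.vecMulLinear, Submodule.map_comap_eq_self (hrange ▸ hDC)⟩
    refine ⟨LinearMap.BilinForm.orthogonal (Matrix.toBilin' 1) W, ?_,
      (hasFullSupport_map_vecMulLinear_iff G W).mp hD⟩
    rw [LinearMap.BilinForm.finrank_orthogonal hB, Module.finrank_fin_fun,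
      (W.equivMapOfInjective _ hinj).finrank_eq, hDr]
  · rintro ⟨U, hUr, hU⟩
    refine ⟨(LinearMap.BilinForm.orthogonal (Matrix.toBilin' 1) U).map G.vecMulLinear,
      hrange ▸ LinearMap.map_le_range, ?_, ?_⟩
    · rw [← (Submodule.equivMapOfInjective _ hinj _).finrank_eq,
        LinearMap.BilinForm.finrank_orthogonal hB, Module.finrank_fin_fun, hUr]
      omega
    · rwa [hasFullSupport_map_vecMulLinear_iff,
        LinearMap.BilinForm.orthogonal_orthogonal hB hrefl]

/-- Being the least element `m` of a set of naturals depends only on the elements up to `k`,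
for any `k ≥ m`. -/
theorem isLeast_congr_of_forall_le {S T : Set ℕ} {m k : ℕ} (hmk : m ≤ k)
    (h : ∀ r ≤ k, r ∈ S ↔ r ∈ T) : IsLeast S m ↔ IsLeast T m := by
  refine and_congr (h m hmk) (forall_congr' fun r => ?_)
  rcases le_total r k with hr | hr
  · rw [h r hr]
  · exact ⟨fun _ _ => hmk.trans hr, fun _ _ => hmk.trans hr⟩

/-- `γ(C) = m` if and only if `m` is the smallest positive integer for
which there exists a `(k-m)`-dimensional subspace of `F_q^k` containing no column of a
generator matrix `G` of `C`. -/
theorem stmt2 {F : Type*} [Field F] [Fintype F] [DecidableEq F] {n k m : ℕ}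
    (G : Matrix (Fin k) (Fin n) F) (hG : LinearIndependent F G)
    (C : Submodule F (Fin n → F)) (hC : C = Submodule.span F (Set.range G))
    (hCk : Module.finrank F C = k) (hm1 : 1 ≤ m) (hmk : m ≤ k) :
    IsLeast (gammaSet C) m ↔
    IsLeast {r : ℕ | 0 < r ∧ ∃ U : Submodule F (Fin k → F),
      Module.finrank F U = k - r ∧ ∀ j : Fin n, (fun i => G i j) ∉ U} m := by
  subst hC
  exact isLeast_congr_of_forall_le hmk fun r hr =>
    mem_gammaSet_iff_exists_finrank_eq_sub G hG hr
end

section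
/- Let q be an odd prime power and let C be a linear [n,k] code over F_q with 1 ≤ k < n and d(C⊥) > 3. Then γ(C) ≤ k − d(C⊥) + 2. -/
/-- If all nonempty fibres of `g` on `T` have exactly two elements, then `T` has even size. -/
theorem even_card_of_fibers_card_two {α β : Type*} [DecidableEq β] (T : Finset α) (g : α → β)
    (h : ∀ t ∈ T, (T.filter fun s => g s = g t).card = 2) : Even T.card := by
  rw [Finset.card_eq_sum_card_image g T]
  refine Finset.even_sum _ fun b hb => ?_
  obtain ⟨t, ht, rfl⟩ := Finset.mem_image.mp hb
  rw [h t ht]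
  exact even_two

section Arc

variable {F ι : Type*} [Field F]

/-- Values of codewords can be prescribed on any at most `m` coordinates of `E`, if they can be
prescribed on any exactly `m` coordinates. -/
theorem exists_mem_eq_of_card_le {C : Submodule F (ι → F)} {E : Finset ι} {m : ℕ}
    (hmE : m ≤ E.card)
    (hsurj : ∀ A ⊆ E, A.card = m → ∀ v : ι → F, ∃ x ∈ C, ∀ i ∈ A, x i = v i)
    {A : Finset ι} (hAE : A ⊆ E) (hA : A.card ≤ m) (v : ι → F) :
    ∃ x ∈ C, ∀ i ∈ A, x i = v i := by
  obtain ⟨A', hAA', hA'E, hA'⟩ := Finset.exists_subsuperset_card_eq hAE hA hmE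
  obtain ⟨x, hx, hxv⟩ := hsurj A' hA'E hA' v
  exact ⟨x, hx, fun i hi => hxv i (hAA' hi)⟩

/-- A code that is MDS of dimension `m` on `E` has a word vanishing on a given set of `m - 1`
coordinates and at no other coordinate of `E`. -/
theorem exists_mem_zero_iff [DecidableEq ι] {C : Submodule F (ι → F)} {E : Finset ι} {m : ℕ}
    (hmE : m ≤ E.card)
    (hsurj : ∀ A ⊆ E, A.card = m → ∀ v : ι → F, ∃ x ∈ C, ∀ i ∈ A, x i = v i)
    (hinj : ∀ A ⊆ E, A.card = m → ∀ x ∈ C, (∀ i ∈ A, x i = 0) → ∀ i ∈ E, x i = 0)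
    {B : Finset ι} (hBE : B ⊆ E) (hB : B.card + 1 = m) :
    ∃ z ∈ C, (∀ i ∈ B, z i = 0) ∧ ∀ t ∈ E, t ∉ B → z t ≠ 0 := by
  obtain ⟨t₀, ht₀E, ht₀B⟩ : ∃ t ∈ E, t ∉ B :=
    Finset.exists_mem_notMem_of_card_lt_card (by omega)
  obtain ⟨z, hz, hzv⟩ := hsurj (insert t₀ B) (Finset.insert_subset ht₀E hBE)
    (by rw [Finset.card_insert_of_notMem ht₀B, hB]) (Pi.single t₀ 1)
  have hzB : ∀ i ∈ B, z i = 0 := fun i hi => by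
    rw [hzv i (Finset.mem_insert_of_mem hi),
      Pi.single_eq_of_ne (ne_of_mem_of_not_mem hi ht₀B)]
  refine ⟨z, hz, hzB, fun t htE htB h0 => ?_⟩
  have h1 := hinj (insert t B) (Finset.insert_subset htE hBE)
    (by rw [Finset.card_insert_of_notMem htB, hB]) z hz
    (by simpa [h0] using hzB) t₀ ht₀E
  rw [hzv t₀ (Finset.mem_insert_self _ _), Pi.single_eq_same] at h1
  exact one_ne_zero h1

/-- For `q` odd, a code that is MDS of dimension `m ≥ 3` on `E` satisfies
`|E| ≤ q + m - 2`. -/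
theorem card_add_two_le_of_mds [Fintype F] [DecidableEq F] [DecidableEq ι]
    (hq : Odd (Fintype.card F)) {C : Submodule F (ι → F)}
    {E : Finset ι} {m : ℕ} (hm : 3 ≤ m) (hmE : m ≤ E.card)
    (hsurj : ∀ A ⊆ E, A.card = m → ∀ v : ι → F, ∃ x ∈ C, ∀ i ∈ A, x i = v i)
    (hinj : ∀ A ⊆ E, A.card = m → ∀ x ∈ C, (∀ i ∈ A, x i = 0) → ∀ i ∈ E, x i = 0) :
    E.card + 2 ≤ Fintype.card F + m := by
  by_contra! hlt
  obtain ⟨B, hBE, hB⟩ := Finset.exists_subset_card_eq (show m - 1 ≤ E.card by omega)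
  obtain ⟨i, hi, j, hj, hij⟩ := Finset.one_lt_card.mp (show 1 < B.card by omega)
  set I := (B.erase i).erase j with hI
  have hIB : I ⊆ B := (Finset.erase_subset _ _).trans (Finset.erase_subset _ _)
  have hIE : I ⊆ E := hIB.trans hBE
  have hIcard : I.card + 3 = m := by
    rw [hI, Finset.card_erase_of_mem (Finset.mem_erase.mpr ⟨hij.symm, hj⟩),
      Finset.card_erase_of_mem hi]
    omega
  have hiI : i ∉ I := by simp [hI]
  have hjI : j ∉ I := by simp [hI]
  have hB' : ∀ s ∈ B, s = i ∨ s = j ∨ s ∈ I := by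
    intro s hs
    simp only [hI, Finset.mem_erase]
    tauto
  obtain ⟨z, hz, hzB, hzT⟩ := exists_mem_zero_iff hmE hsurj hinj hBE (by omega)
  obtain ⟨y, hy, hyv⟩ := exists_mem_eq_of_card_le hmE hsurj hBE (by omega)
    (fun s => if s ∈ I then 0 else 1)
  have hyI : ∀ s ∈ I, y s = 0 := fun s hs => by rw [hyv s (hIB hs), if_pos hs]
  have hyi : y i = 1 := by rw [hyv i hi, if_neg hiI]
  have hyj : y j = 1 := by rw [hyv j hj, if_neg hjI]
  set T := E \ B with hT
  have hTcard : T.card + (m - 1) = E.card := by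
    rw [hT, ← hB, Finset.card_sdiff_add_card_eq_card hBE]
  have hzT' : ∀ t ∈ T, z t ≠ 0 := fun t ht =>
    hzT t (Finset.mem_sdiff.mp ht).1 (Finset.mem_sdiff.mp ht).2
  set g : ι → F := fun t => -y t / z t with hg
  have hgzero : ∀ s ∈ T, ∀ c : F, g s = c ↔ y s + c * z s = 0 := by
    intro s hs c
    rw [hg]
    simp only
    rw [div_eq_iff (hzT' s hs), neg_eq_iff_add_eq_zero]
  have key : ∀ t ∈ T, (T.filter fun s => g s = g t).card = 2 ∧ T.card = Fintype.card F := by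
    intro t ht
    have htE := (Finset.mem_sdiff.mp ht).1
    have htB := (Finset.mem_sdiff.mp ht).2
    have htI : t ∉ I := fun h => htB (hIB h)
    set w : ι → F := y + g t • z with hw
    have hwC : w ∈ C := C.add_mem hy (C.smul_mem _ hz)
    have hw_apply : ∀ s, w s = y s + g t * z s := fun s => rfl
    have hwI : ∀ s ∈ I, w s = 0 := fun s hs => by
      rw [hw_apply, hyI s hs, hzB s (hIB hs)]; ring
    have hwt : w t = 0 := by rw [hw_apply]; exact (hgzero t ht _).mp rfl
    have hwi : w i = 1 := by rw [hw_apply, hyi, hzB i hi]; ring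
    have hwj : w j = 1 := by rw [hw_apply, hyj, hzB j hj]; ring
    have hit : i ≠ t := fun h => htB (h ▸ hi)
    have hjt : j ≠ t := fun h => htB (h ▸ hj)
    have hle : (T.filter fun s => g s = g t).card ≤ 2 := by
      by_contra! h3
      obtain ⟨R, hR, hRcard⟩ := Finset.exists_subset_card_eq (Nat.succ_le_of_lt h3)
      have hRT : ∀ s ∈ R, s ∈ T ∧ w s = 0 := fun s hs => by
        obtain ⟨h1, h2⟩ := Finset.mem_filter.mp (hR hs)
        exact ⟨h1, (hgzero s h1 _).mp h2⟩
      have hdisj : Disjoint I R := Finset.disjoint_left.mpr fun s hs hs' =>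
        (Finset.mem_sdiff.mp (hRT s hs').1).2 (hIB hs)
      have := hinj (I ∪ R)
        (Finset.union_subset hIE fun s hs => (Finset.mem_sdiff.mp (hRT s hs).1).1)
        (by rw [Finset.card_union_of_disjoint hdisj]; omega) w hwC
        (fun s hs => (Finset.mem_union.mp hs).elim (hwI s) fun h => (hRT s h).2) i (hBE hi)
      exact one_ne_zero (hwi.symm.trans this)
    have hPi : i ∉ insert t I := by simp [hit, hiI]
    obtain ⟨x, hx, hx0, hxne⟩ := exists_mem_zero_iff hmE hsurj hinj
      (B := insert i (insert t I))
      (Finset.insert_subset (hBE hi) (Finset.insert_subset htE hIE))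
      (by rw [Finset.card_insert_of_notMem hPi, Finset.card_insert_of_notMem htI]; omega)
    have hjT : j ∉ T.erase t := by simp [hT, hj]
    set S := insert j (T.erase t) with hS
    have hScard : S.card = T.card := by
      rw [hS, Finset.card_insert_of_notMem hjT, Finset.card_erase_add_one ht]
    have hSE : S ⊆ E := Finset.insert_subset (hBE hj)
      ((Finset.erase_subset _ _).trans Finset.sdiff_subset)
    have hSI : ∀ s ∈ S, s ∉ insert t I := by
      intro s hs
      rcases Finset.mem_insert.mp hs with rfl | hs
      · simp [hjt, hjI]
      · obtain ⟨h1, h2⟩ := Finset.mem_erase.mp hs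
        have : s ∉ I := fun h => (Finset.mem_sdiff.mp h2).2 (hIB h)
        simp [h1, this]
    have hSi : ∀ s ∈ S, s ≠ i := by
      rintro s hs rfl
      rcases Finset.mem_insert.mp hs with h | hs
      · exact hij h
      · exact (Finset.mem_sdiff.mp (Finset.mem_of_mem_erase hs)).2 hi
    have hxS : ∀ s ∈ S, x s ≠ 0 := fun s hs => hxne s (hSE hs) fun h =>
      (Finset.mem_insert.mp h).elim (hSi s hs) (hSI s hs)
    set μ : ι → F := fun s => -w s / x s with hμ
    have hμzero : ∀ s ∈ S, ∀ c : F, μ s = c ↔ w s + c * x s = 0 := by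
      intro s hs c
      rw [hμ]
      simp only
      rw [div_eq_iff (hxS s hs), neg_eq_iff_add_eq_zero]
    have hμinj : Set.InjOn μ S := by
      intro s hs s' hs' hss'
      by_contra hne
      have hs1 : s ∉ insert s' (insert t I) := fun h =>
        (Finset.mem_insert.mp h).elim hne (hSI s hs)
      have := hinj (insert s (insert s' (insert t I)))
        (Finset.insert_subset (hSE hs) (Finset.insert_subset (hSE hs')
          (Finset.insert_subset htE hIE)))
        (by rw [Finset.card_insert_of_notMem hs1, Finset.card_insert_of_notMem (hSI s' hs'),
              Finset.card_insert_of_notMem htI, hIcard])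
        (w + μ s • x) (C.add_mem hwC (C.smul_mem _ hx))
        (by
          intro r hr
          change w r + μ s * x r = 0
          rcases Finset.mem_insert.mp hr with rfl | hr
          · exact (hμzero r hs _).mp rfl
          rcases Finset.mem_insert.mp hr with rfl | hr
          · exact (hμzero r hs' _).mp hss'.symm
          · rw [hx0 r (Finset.mem_insert_of_mem hr)]
            rcases Finset.mem_insert.mp hr with rfl | hr
            · rw [hwt]; ring
            · rw [hwI r hr]; ring) i (hBE hi)
      change w i + μ s * x i = 0 at this
      rw [hwi, hx0 i (Finset.mem_insert_self _ _), mul_zero, add_zero] at this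
      exact one_ne_zero this
    have himg : (S.image μ).card = T.card := by
      rw [Finset.card_image_of_injOn hμinj, hScard]
    have hcard : T.card = Fintype.card F :=
      le_antisymm (himg ▸ Finset.card_le_univ _) (by omega)
    have hall : S.image μ = Finset.univ :=
      (Finset.card_eq_iff_eq_univ _).mp (himg.trans hcard)
    obtain ⟨s, hs, hs0⟩ := Finset.mem_image.mp (hall ▸ Finset.mem_univ (0 : F))
    have hws : w s = 0 := by simpa using (hμzero s hs 0).mp hs0
    have hsT : s ∈ T.erase t := by
      rcases Finset.mem_insert.mp hs with rfl | hs
      · exact absurd (hwj.symm.trans hws) one_ne_zero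
      · exact hs
    obtain ⟨hst, hsT⟩ := Finset.mem_erase.mp hsT
    have hgt : 1 < (T.filter fun s => g s = g t).card :=
      Finset.one_lt_card.mpr ⟨s, Finset.mem_filter.mpr ⟨hsT, (hgzero s hsT _).mpr hws⟩,
        t, Finset.mem_filter.mpr ⟨ht, rfl⟩, hst⟩
    exact ⟨by omega, hcard⟩
  have hpos : 0 < T.card := by omega
  obtain ⟨t, ht⟩ := Finset.card_pos.mp hpos
  have heven := even_card_of_fibers_card_two T g fun t ht => (key t ht).1
  rw [(key t ht).2] at heven
  exact (Nat.not_even_iff_odd.mpr hq) heven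

/-- For `q` odd, a code that is MDS of dimension `m ≥ 3` on `E` has a word nonzero at every
coordinate of `E`. -/
theorem exists_mem_forall_ne_zero_of_mds [Fintype F] [DecidableEq F] [DecidableEq ι]
    (hq : Odd (Fintype.card F)) {C : Submodule F (ι → F)} {E : Finset ι} {m : ℕ} (hm : 3 ≤ m) (hmE : m ≤ E.card)
    (hsurj : ∀ A ⊆ E, A.card = m → ∀ v : ι → F, ∃ x ∈ C, ∀ i ∈ A, x i = v i)
    (hinj : ∀ A ⊆ E, A.card = m → ∀ x ∈ C, (∀ i ∈ A, x i = 0) → ∀ i ∈ E, x i = 0) :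
    ∃ y ∈ C, ∀ i ∈ E, y i ≠ 0 := by
  have hbound := card_add_two_le_of_mds hq hm hmE hsurj hinj
  obtain ⟨B, hBE, hB⟩ := Finset.exists_subset_card_eq (show m - 1 ≤ E.card by omega)
  obtain ⟨z, hz, hzB, hzT⟩ := exists_mem_zero_iff hmE hsurj hinj hBE (by omega)
  obtain ⟨y, hy, hyB⟩ := exists_mem_eq_of_card_le hmE hsurj hBE (by omega) (fun _ => 1)
  have hTcard : (E \ B).card + (m - 1) = E.card := by
    rw [← hB, Finset.card_sdiff_add_card_eq_card hBE]
  obtain ⟨c, -, hc⟩ : ∃ c ∈ (Finset.univ : Finset F), c ∉ (E \ B).image fun t => -y t / z t := by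
    refine Finset.exists_mem_notMem_of_card_lt_card (Finset.card_image_le.trans_lt ?_)
    rw [Finset.card_univ]
    omega
  refine ⟨y + c • z, C.add_mem hy (C.smul_mem _ hz), fun i hiE h0 => ?_⟩
  change y i + c * z i = 0 at h0
  by_cases hiB : i ∈ B
  · rw [hyB i hiB, hzB i hiB, mul_zero, add_zero] at h0
    exact one_ne_zero h0
  · refine hc (Finset.mem_image.mpr ⟨i, Finset.mem_sdiff.mpr ⟨hiE, hiB⟩, ?_⟩)
    rw [div_eq_iff (hzT i hiE hiB), neg_eq_iff_add_eq_zero, h0]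

end Arc

section Restriction

variable {F : Type*} [Field F] {n : ℕ}

/-- Restriction of the words of `C` to the coordinates in `A`. -/
def restrictTo (C : Submodule F (Fin n → F)) (A : Finset (Fin n)) : C →ₗ[F] (A → F) :=
  (LinearMap.funLeft F F ((↑) : A → Fin n)).comp C.subtype

@[simp]
theorem restrictTo_apply (C : Submodule F (Fin n → F)) (A : Finset (Fin n)) (x : C) (i : A) :
    restrictTo C A x i = (x : Fin n → F) i := rfl

/-- A code restricts onto every set of coordinates smaller than the minimum dual distance. -/
theorem restrictTo_surjective [DecidableEq F] {C : Submodule F (Fin n → F)} {d : ℕ}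
    (hd : d ∈ lowerBounds (dualWeights C)) {A : Finset (Fin n)} (hA : A.card < d) :
    Function.Surjective (restrictTo C A) := by
  rw [← LinearMap.range_eq_top]
  by_contra hne
  obtain ⟨f, hf, hfr⟩ := Submodule.exists_le_ker_of_lt_top _ (lt_top_iff_ne_top.mpr hne)
  set y : Fin n → F := fun i => if h : i ∈ A then f (Pi.single ⟨i, h⟩ 1) else 0 with hy
  have hyA : ∀ i : A, y i = f (Pi.single i 1) := fun i => by simp [hy]
  have hf_apply : ∀ v : A → F, f v = ∑ i : A, v i * y i := by
    intro v
    conv_lhs => rw [LinearMap.pi_apply_eq_sum_univ f v]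
    refine Finset.sum_congr rfl fun i _ => ?_
    rw [hyA, smul_eq_mul]
    congr 2
    ext j
    simp [Pi.single_apply, eq_comm]
  have hy_supp : ∀ i, i ∉ A → y i = 0 := fun i hi => by simp [hy, hi]
  have hmem : wt y ∈ dualWeights C := by
    refine ⟨y, ?_, fun x hx => ?_, rfl⟩
    · rintro h0
      refine hf (LinearMap.ext fun v => ?_)
      rw [hf_apply]
      simp [h0]
    · have h1 : f (restrictTo C A ⟨x, hx⟩) = 0 := hfr ⟨_, rfl⟩
      rw [hf_apply] at h1
      simp only [restrictTo_apply] at h1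
      rw [Finset.sum_coe_sort A fun i => x i * y i] at h1
      rw [← h1]
      exact (Finset.sum_subset (Finset.subset_univ A) fun i _ hi => by
        rw [hy_supp i hi, mul_zero]).symm
  have hwt : wt y ≤ A.card := Finset.card_le_card fun i hi => by
    by_contra h
    exact (Finset.mem_filter.mp hi).2 (hy_supp i h)
  exact absurd (hd hmem) (by omega)

end Restriction

/-- for `q` odd and a linear `[n,k]` code `C` over `F_q` with
`1 ≤ k < n` and `d(C⊥) > 3`, we have `γ(C) ≤ k - d(C⊥) + 2`. -/
theorem stmt11 {F : Type*} [Field F] [Fintype F] [DecidableEq F] {n k d : ℕ}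
    (hq : Odd (Fintype.card F))
    (C : Submodule F (Fin n → F)) (hCk : Module.finrank F C = k)
    (hk1 : 1 ≤ k) (hkn : k < n)
    (hd : IsLeast (dualWeights C) d) (hd3 : 3 < d) :
    ∃ D : Submodule F (Fin n → F), D ≤ C ∧ HasFullSupport D ∧
      (Module.finrank F D : ℤ) ≤ (k : ℤ) - (d : ℤ) + 2 := by
  classical
  have hdn : d ≤ n := by
    obtain ⟨y, -, -, rfl⟩ := hd.1
    exact (Finset.card_le_univ _).trans_eq (Fintype.card_fin n)
  have hker : ∀ A : Finset (Fin n), A.card = d - 1 →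
      Module.finrank F (LinearMap.ker (restrictTo C A)) + (d - 1) = k := by
    intro A hA
    have h := LinearMap.finrank_range_add_finrank_ker (restrictTo C A)
    rw [LinearMap.range_eq_top.mpr (restrictTo_surjective hd.2 (by omega)), finrank_top,
      Module.finrank_fintype_fun_eq_card, Fintype.card_coe, hA, hCk] at h
    omega
  obtain ⟨J, -, hJ⟩ := Finset.exists_subset_card_eq
    (show d - 1 ≤ (Finset.univ : Finset (Fin n)).card by
      rw [Finset.card_univ, Fintype.card_fin]; omega)
  set K := LinearMap.ker (restrictTo C J)
  have hKcard : Module.finrank F K + (d - 1) = k := hker J hJ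
  set E : Finset (Fin n) := Finset.univ.filter fun i => ∀ x ∈ K, (x : Fin n → F) i = 0 with hE
  have hmemE : ∀ i, i ∈ E ↔ ∀ x ∈ K, (x : Fin n → F) i = 0 := fun i => by simp [hE]
  have hJE : J ⊆ E := fun i hi => (hmemE i).mpr fun x hx => congrFun hx ⟨i, hi⟩
  obtain ⟨y, hyC, hyE⟩ := exists_mem_forall_ne_zero_of_mds hq (C := C) (E := E) (m := d - 1)
    (by omega) (hJ ▸ Finset.card_le_card hJE)
    (by
      intro A _ hA v
      obtain ⟨x, hx⟩ := restrictTo_surjective hd.2 (show A.card < d by omega) fun i => v i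
      exact ⟨x, x.2, fun i hi => congrFun hx ⟨i, hi⟩⟩)
    (by
      intro A hAE hA x hx hxA i hi
      have hle : K ≤ LinearMap.ker (restrictTo C A) := fun u hu =>
        LinearMap.mem_ker.mpr (funext fun i => (hmemE i).mp (hAE i.2) u hu)
      have hKA : K = LinearMap.ker (restrictTo C A) :=
        Submodule.eq_of_le_of_finrank_eq hle (by have := hker A hA; omega)
      refine (hmemE i).mp hi ⟨x, hx⟩ ?_
      rw [hKA]
      exact LinearMap.mem_ker.mpr (funext fun i => hxA i i.2))
  refine ⟨K.map C.subtype ⊔ Submodule.span F {y}, ?_, fun i => ?_, ?_⟩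
  · exact sup_le (Submodule.map_subtype_le _ _) ((Submodule.span_singleton_le_iff_mem _ _).mpr hyC)
  · by_cases hi : i ∈ E
    · exact ⟨y, Submodule.mem_sup_right (Submodule.mem_span_singleton_self y), hyE i hi⟩
    · rw [hmemE] at hi
      push Not at hi
      obtain ⟨x, hx, hxi⟩ := hi
      exact ⟨x, Submodule.mem_sup_left (Submodule.mem_map_of_mem (f := C.subtype) hx), hxi⟩
  · have h1 := Submodule.finrank_add_le_finrank_add_finrank (K.map C.subtype)
      (Submodule.span F {y})
    have h2 : Module.finrank F (Submodule.span F {y}) ≤ 1 := by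
      simpa using finrank_span_le_card (R := F) ({y} : Set (Fin n → F))
    have h3 : Module.finrank F (K.map C.subtype) = Module.finrank F K :=
      
      LinearEquiv.finrank_eq (Submodule.equivMapOfInjective _ C.subtype_injective K).symm
    omega
end

section
/- Let C be a linear [n,k] code over F_q with 1 ≤ k < n and d(C⊥) = 4. Then k ≥ 3, the number of (k−2)-dimensional subcodes D of C with Supp(D) = E is strictly positive, and consequently γ(C) ≤ k − 2 = k − d(C⊥) + 2. -/
/-- The subcode of `C` consisting of the codewords that vanish on the coordinates in `S`. -/
def vanishingSubcode {F : Type*} [Field F] {n : ℕ} (C : Submodule F (Fin n → F))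
    (S : Finset (Fin n)) : Submodule F (Fin n → F) :=
  (LinearMap.ker ((LinearMap.funLeft F F (Subtype.val : S → Fin n)).domRestrict C)).map C.subtype

section VanishingSubcode

variable {F : Type*} [Field F] {n : ℕ} {C : Submodule F (Fin n → F)}

theorem mem_vanishingSubcode {S : Finset (Fin n)} {x : Fin n → F} :
    x ∈ vanishingSubcode C S ↔ x ∈ C ∧ ∀ i ∈ S, x i = 0 := by
  simp only [vanishingSubcode, Submodule.mem_map, LinearMap.mem_ker]
  constructor
  · rintro ⟨y, hy, rfl⟩
    exact ⟨y.2, fun i hi => congrFun hy ⟨i, hi⟩⟩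
  · rintro ⟨hx, h⟩
    exact ⟨⟨x, hx⟩, funext fun i => h i i.2, rfl⟩

variable [DecidableEq F]

/-- Fewer than `d(C⊥)` coordinates impose independent conditions on `C`. -/
theorem finrank_vanishingSubcode_add_card {S : Finset (Fin n)}
    (hS : ∀ w ∈ dualWeights C, S.card < w) :
    Module.finrank F (vanishingSubcode C S) + S.card = Module.finrank F C := by
  set φ := (LinearMap.funLeft F F (Subtype.val : S → Fin n)).domRestrict C
  have hsurj : LinearMap.range φ = ⊤ := by
    by_contra hne
    obtain ⟨f, hf, hle⟩ := Submodule.exists_le_ker_of_lt_top _ (lt_top_iff_ne_top.2 hne)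
    let y : Fin n → F := fun i => if h : i ∈ S then f (Pi.single ⟨i, h⟩ 1) else 0
    have hyf (x : Fin n → F) : ∑ i, x i * y i = f (fun i : S => x i) := by
      rw [LinearMap.pi_apply_eq_sum_univ f, ← Finset.sum_subset (Finset.subset_univ S)
        (fun i _ hi => by simp [y, hi]), ← Finset.sum_coe_sort S]
      refine Finset.sum_congr rfl fun i _ => ?_
      simp only [y, i.2, dite_true, smul_eq_mul]
      congr 2
      ext j
      simp [Pi.single_apply, eq_comm]
    refine absurd (hS (wt y) ⟨y, ?_, fun x hx => ?_, rfl⟩) (not_lt.2 ?_)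
    · intro hy
      refine hf (LinearMap.ext fun z => ?_)
      have h := hyf fun i => if h : i ∈ S then z ⟨i, h⟩ else 0
      simpa [hy] using h.symm
    · rw [hyf]
      exact hle ⟨⟨x, hx⟩, rfl⟩
    · refine Finset.card_le_card fun i hi => ?_
      by_contra h
      simp [y, h] at hi
  have h := LinearMap.finrank_range_add_finrank_ker φ
  rw [hsurj, finrank_top, Module.finrank_fintype_fun_eq_card, Fintype.card_coe] at h
  rw [vanishingSubcode, Submodule.finrank_map_subtype_eq, ← h, add_comm]

theorem card_filter_vanishing [Fintype F] [Fintype C] {S : Finset (Fin n)}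
    (hS : ∀ w ∈ dualWeights C, S.card < w) :
    (Finset.univ.filter fun x : C => ∀ i ∈ S, (x : Fin n → F) i = 0).card =
      Fintype.card F ^ (Module.finrank F C - S.card) := by
  classical
  have hcard : Fintype.card (vanishingSubcode C S) =
      (Finset.univ.filter fun x : C => ∀ i ∈ S, (x : Fin n → F) i = 0).card := by
    rw [← Fintype.card_subtype]
    exact Fintype.card_congr
      { toFun := fun x => ⟨⟨x, (mem_vanishingSubcode.1 x.2).1⟩, (mem_vanishingSubcode.1 x.2).2⟩
        invFun := fun x => ⟨x, mem_vanishingSubcode.2 ⟨x.1.2, x.2⟩⟩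
        left_inv := fun _ => rfl
        right_inv := fun _ => rfl }
  rw [← hcard, Module.card_eq_pow_finrank (K := F), ← finrank_vanishingSubcode_add_card hS,
    Nat.add_sub_cancel]

/-- If `d(C⊥) ≥ 4`, some codeword has no zero among the coordinates that vanish on
`vanishingSubcode C A`, for any three coordinates `A`. -/
theorem exists_forall_ne_zero_of_vanishing [Fintype F] {A : Finset (Fin n)} (hA : A.card = 3)
    (hd : ∀ w ∈ dualWeights C, 4 ≤ w) :
    ∃ x ∈ C, ∀ i, (∀ y ∈ vanishingSubcode C A, y i = 0) → x i ≠ 0 := by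
  classical
  by_contra! hno
  set T : Finset (Fin n) := Finset.univ.filter fun i => ∀ y ∈ vanishingSubcode C A, y i = 0
    with hT
  have hmemT (i : Fin n) : i ∈ T ↔ ∀ y ∈ vanishingSubcode C A, y i = 0 := by simp [hT]
  have hlt {S : Finset (Fin n)} (hS : S.card ≤ 3) : ∀ w ∈ dualWeights C, S.card < w :=
    fun w hw => lt_of_le_of_lt hS (hd w hw)
  obtain ⟨r, hr⟩ : ∃ r, Module.finrank F C = r + 3 :=
    ⟨_, by rw [← finrank_vanishingSubcode_add_card (hlt hA.le), hA]⟩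
  set q : ℤ := (Fintype.card F : ℤ)
  set m : ℤ := (T.card : ℤ) with hm
  have hq2 : 1 < q := Nat.one_lt_cast.2 (Fintype.one_lt_card (α := F))
  let z : C → ℤ := fun x => ∑ i ∈ T, if (x : Fin n → F) i = 0 then 1 else 0
  have hz (x : C) : z x = (T.filter fun i => (x : Fin n → F) i = 0).card := by simp [z]
  have hcount (S : Finset (Fin n)) (j : ℕ) (hj : S.card + j = 3) :
      ∑ x : C, (if ∀ i ∈ S, (x : Fin n → F) i = 0 then (1 : ℤ) else 0) = q ^ r * q ^ j := by
    rw [Finset.sum_boole, card_filter_vanishing (hlt (by omega)), hr,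
      show r + 3 - S.card = r + j by omega, pow_add]
    push_cast
    rfl
  have hzero : ∑ _x : C, (1 : ℤ) = q ^ r * q ^ 3 := by
    simpa using hcount ∅ 3 rfl
  have hone : ∑ x, z x = m * (q ^ r * q ^ 2) := by
    rw [Finset.sum_comm, Finset.sum_congr rfl (g := fun _ => q ^ r * q ^ 2)]
    · simp [hm]
    · intro i _
      simpa using hcount {i} 2 rfl
  have hpair (i j : Fin n) : ∑ x : C, (if (x : Fin n → F) i = 0 then (1 : ℤ) else 0) *
      (if (x : Fin n → F) j = 0 then 1 else 0) =
      q ^ r * q + if i = j then q ^ r * q ^ 2 - q ^ r * q else 0 := by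
    by_cases hij : i = j
    · subst hij
      rw [if_pos rfl, add_sub_cancel, ← hcount {i} 2 rfl]
      refine Finset.sum_congr rfl fun x _ => ?_
      by_cases hx : (x : Fin n → F) i = 0 <;> simp [hx]
    · have h := hcount {i, j} 1 (by rw [Finset.card_pair hij])
      rw [pow_one] at h
      rw [if_neg hij, add_zero, ← h]
      refine Finset.sum_congr rfl fun x _ => ?_
      by_cases hx : (x : Fin n → F) i = 0 <;> simp [hx]
  have htwo : ∑ x, z x * z x = m * m * (q ^ r * q) + m * (q ^ r * q ^ 2 - q ^ r * q) := by
    simp only [z, Finset.sum_mul_sum]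
    rw [Finset.sum_comm]
    simp_rw [Finset.sum_comm (s := (Finset.univ : Finset C)), hpair, Finset.sum_add_distrib]
    simp [hm]
    ring
  have hvan : ∑ x : C, (1 - z x) * (2 - z x) = q ^ r * ((1 - m) * (2 - m)) := by
    have h := hcount A 0 (by omega)
    rw [pow_zero, mul_one] at h
    rw [← h, Finset.sum_mul]
    refine Finset.sum_congr rfl fun x _ => ?_
    by_cases hx : ∀ i ∈ A, (x : Fin n → F) i = 0
    · have hzx : z x = m := by
        rw [hz, hm, Finset.filter_true_of_mem fun i hi =>
          (hmemT i).1 hi x (mem_vanishingSubcode.2 ⟨x.2, hx⟩)]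
      rw [if_pos hx, hzx, one_mul]
    · have hpos : 1 ≤ z x := by
        obtain ⟨i, hi, hxi⟩ := hno x x.2
        rw [hz]
        exact_mod_cast Finset.card_pos.2 ⟨i, Finset.mem_filter.2 ⟨(hmemT i).2 hi, hxi⟩⟩
      have hle : z x ≤ 2 := by
        by_contra! hgt
        rw [hz] at hgt
        obtain ⟨B, hB, hBcard⟩ := Finset.exists_subset_card_eq
          (show 3 ≤ (T.filter fun i => (x : Fin n → F) i = 0).card by exact_mod_cast hgt)
        have hAB : vanishingSubcode C A ≤ vanishingSubcode C B := fun y hy =>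
          mem_vanishingSubcode.2 ⟨(mem_vanishingSubcode.1 hy).1, fun i hi =>
            (hmemT i).1 (Finset.mem_filter.1 (hB hi)).1 y hy⟩
        have heq := Submodule.eq_of_le_of_finrank_eq hAB (by
          have h1 := finrank_vanishingSubcode_add_card (hlt hA.le)
          have h2 := finrank_vanishingSubcode_add_card (hlt hBcard.le)
          omega)
        have hxB : (x : Fin n → F) ∈ vanishingSubcode C B :=
          mem_vanishingSubcode.2 ⟨x.2, fun i hi => (Finset.mem_filter.1 (hB hi)).2⟩
        rw [← heq] at hxB
        exact hx (mem_vanishingSubcode.1 hxB).2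
      rw [if_neg hx, zero_mul]
      obtain h | h : z x = 1 ∨ z x = 2 := by omega
      all_goals simp [h]
  have hexpand : ∑ x : C, (1 - z x) * (2 - z x) =
      2 * ∑ _x : C, (1 : ℤ) - 3 * ∑ x, z x + ∑ x, z x * z x := by
    rw [Finset.mul_sum, Finset.mul_sum, ← Finset.sum_sub_distrib, ← Finset.sum_add_distrib]
    exact Finset.sum_congr rfl fun x _ => by ring
  rw [hvan, hzero, hone, htwo] at hexpand
  have hprod : q ^ r * ((q - 1) * (m ^ 2 - (2 * q + 3) * m + 2 * (q ^ 2 + q + 1))) = 0 := by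
    linear_combination -hexpand
  have hqr : 0 < q ^ r := by positivity
  have hquad : 0 < m ^ 2 - (2 * q + 3) * m + 2 * (q ^ 2 + q + 1) := by
    nlinarith [sq_nonneg (2 * m - 2 * q - 3)]
  have hq1 : 0 < q - 1 := by linarith
  exact (mul_pos hqr (mul_pos hq1 hquad)).ne' hprod

end VanishingSubcode

/-- for a linear `[n,k]` code `C` over `F_q` with `1 ≤ k < n` and
`d(C⊥) = 4`, we have `k ≥ 3`, the number of `(k-2)`-dimensional subcodes of `C` of full
support is strictly positive, and consequently `γ(C) ≤ k - 2 = k - d(C⊥) + 2`. -/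
theorem stmt12 {F : Type*} [Field F] [Fintype F] [DecidableEq F] {n k : ℕ}
    (C : Submodule F (Fin n → F)) (hCk : Module.finrank F C = k)
    (hk1 : 1 ≤ k) (hkn : k < n)
    (hd : IsLeast (dualWeights C) 4) :
    3 ≤ k ∧
    0 < Set.ncard {D : Submodule F (Fin n → F) |
        D ≤ C ∧ Module.finrank F D = k - 2 ∧ HasFullSupport D} ∧
    ∃ D : Submodule F (Fin n → F), D ≤ C ∧ HasFullSupport D ∧
      Module.finrank F D ≤ k - 2 := by
  classical
  obtain ⟨⟨y, -, -, hy⟩, hmin⟩ := hd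
  have hd4 : ∀ w ∈ dualWeights C, 4 ≤ w := fun w hw => hmin hw
  have hn : 4 ≤ n := by
    rw [← hy]
    exact (Finset.card_filter_le _ _).trans_eq (Finset.card_fin n)
  obtain ⟨A, -, hA⟩ := Finset.exists_subset_card_eq
    (show 3 ≤ (Finset.univ : Finset (Fin n)).card by simp; omega)
  have hK := finrank_vanishingSubcode_add_card (C := C) (S := A)
    fun w hw => hA.trans_lt (hd4 w hw)
  obtain ⟨x, hxC, hx⟩ := exists_forall_ne_zero_of_vanishing hA hd4
  obtain ⟨a, ha⟩ := Finset.card_pos.1 (show 0 < A.card by omega)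
  have hxK : x ∉ vanishingSubcode C A := fun h =>
    hx a (fun y hy => (mem_vanishingSubcode.1 hy).2 a ha) ((mem_vanishingSubcode.1 h).2 a ha)
  have hx0 : x ≠ 0 := fun h => hxK (h ▸ Submodule.zero_mem _)
  have hle : vanishingSubcode C A ⊔ Submodule.span F {x} ≤ C :=
    sup_le (fun y hy => (mem_vanishingSubcode.1 hy).1)
      ((Submodule.span_singleton_le_iff_mem _ _).2 hxC)
  have hrank : Module.finrank F ↥(vanishingSubcode C A ⊔ Submodule.span F {x}) = k - 2 := by
    have h := Submodule.finrank_sup_add_finrank_inf_eq (vanishingSubcode C A)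
      (Submodule.span F {x})
    rw [((Submodule.disjoint_span_singleton' hx0).2 hxK).eq_bot, finrank_bot,
      finrank_span_singleton hx0] at h
    omega
  have hfull : HasFullSupport (vanishingSubcode C A ⊔ Submodule.span F {x}) := by
    intro i
    by_cases hi : ∀ y ∈ vanishingSubcode C A, y i = 0
    · exact ⟨x, Submodule.mem_sup_right (Submodule.mem_span_singleton_self x), hx i hi⟩
    · push Not at hi
      obtain ⟨y, hyK, hyi⟩ := hi
      exact ⟨y, Submodule.mem_sup_left hyK, hyi⟩
  exact ⟨by omega, (Set.ncard_pos (Set.toFinite _)).2 ⟨_, hle, hrank, hfull⟩,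
    _, hle, hfull, hrank.le⟩
end

section
/- Let C be a linear [n,k] code over F_q with 1 ≤ k < n and d(C⊥) ≥ 4, and set t = d(C⊥) − 1. If γ(C) > k − d(C⊥) + 2, then there exists an MDS code over F_q of length q + t − 1 and dimension t (hence of minimum Hamming weight q). -/
/-- The restriction of the words of a code `C` to the coordinates listed by `T`. -/
def Submodule.restrictCoords {F : Type*} [Field F] {n m : ℕ}
    (C : Submodule F (Fin n → F)) (T : Fin m → Fin n) : C →ₗ[F] (Fin m → F) :=
  LinearMap.funLeft F F T ∘ₗ C.subtype

/-- A code whose dual has no nonzero word of weight at most `m` projects onto any `m` distinct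
coordinates. -/
theorem restrictCoords_surjective {F : Type*} [Field F] [DecidableEq F] {n m : ℕ}
    {C : Submodule F (Fin n → F)} (hC : ∀ w ∈ dualWeights C, m < w)
    {T : Fin m → Fin n} (hT : Function.Injective T) :
    Function.Surjective (C.restrictCoords T) := by
  rw [← LinearMap.range_eq_top]
  by_contra hne
  obtain ⟨f, hf0, hf⟩ := Submodule.exists_le_ker_of_lt_top _ (lt_top_iff_ne_top.2 hne)
  have hfs : ∀ u : Fin m → F, f u = ∑ a, u a * f (Pi.single a 1) := by
    intro u
    conv_lhs => rw [pi_eq_sum_univ' u]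
    simp
  set y : Fin n → F := Function.extend T (fun a => f (Pi.single a 1)) 0 with hy
  have hyT : ∀ a, y (T a) = f (Pi.single a 1) := fun a => hT.extend_apply _ _ a
  have hy0 : ∀ i, i ∉ Set.range T → y i = 0 := fun i hi => by
    rw [hy, Function.extend_apply' _ _ _ (by simpa using hi)]; rfl
  have hmem : wt y ∈ dualWeights C := by
    refine ⟨y, ?_, ?_, rfl⟩
    · intro h
      apply hf0
      ext a
      simp [← hyT, h]
    · intro x hx
      rw [← Fintype.sum_of_injective T hT (fun a => x (T a) * f (Pi.single a 1)) _
        (fun i hi => by simp [hy0 i hi]) (fun a => by rw [hyT])]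
      have : f (C.restrictCoords T ⟨x, hx⟩) = 0 := hf ⟨⟨x, hx⟩, rfl⟩
      rw [hfs] at this
      exact this
  have hle : wt y ≤ m := by
    calc wt y ≤ (Finset.univ.image T).card := by
          refine Finset.card_le_card fun i hi => ?_
          by_contra hni
          exact (Finset.mem_filter.1 hi).2 (hy0 i (by simpa using hni))
      _ ≤ m := Finset.card_image_le.trans (by simp)
  exact absurd (hC _ hmem) (by omega)

/-- A code is MDS as soon as any `t` distinct coordinates form an information set. -/
theorem isLeast_weights_of_bijective {F : Type*} [Field F] [DecidableEq F] {N t : ℕ}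
    {C : Submodule F (Fin N → F)} (ht : 0 < t) (htN : t ≤ N)
    (h : ∀ T : Fin t → Fin N, Function.Injective T → Function.Bijective (C.restrictCoords T)) :
    Module.finrank F C = t ∧ IsLeast {w : ℕ | ∃ x ∈ C, x ≠ 0 ∧ wt x = w} (N - t + 1) := by
  have hcast := h (Fin.castLE htN) (Fin.castLE_injective htN)
  have hwt : ∀ x : Fin N → F, wt x + (Finset.univ.filter fun i => x i = 0).card = N := by
    intro x
    have := Finset.card_filter_add_card_filter_not (s := (Finset.univ : Finset (Fin N)))
      (fun i => x i = 0)
    rw [Finset.card_univ, Fintype.card_fin, add_comm] at this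
    exact this
  have hlow : ∀ x ∈ C, x ≠ 0 → N - t + 1 ≤ wt x := by
    intro x hx hx0
    by_contra hlt
    have hz : t ≤ (Finset.univ.filter fun i => x i = 0).card := by
      have := hwt x
      omega
    obtain ⟨s, hs, hst⟩ := Finset.exists_subset_card_eq hz
    have hinj := (h (s.orderEmbOfFin hst) (s.orderEmbOfFin hst).injective).1
    have hx' : (⟨x, hx⟩ : C) = 0 := hinj <| by
      rw [map_zero]
      ext a
      exact (Finset.mem_filter.1 (hs (s.orderEmbOfFin_mem hst a))).2
    exact hx0 (congrArg Subtype.val hx')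
  refine ⟨by simpa using (LinearEquiv.ofBijective _ hcast).finrank_eq, ?_, ?_⟩
  · obtain ⟨⟨x, hx⟩, hxe⟩ := hcast.2 (Pi.single ⟨0, ht⟩ 1)
    have hxa : ∀ a, x (Fin.castLE htN a) = (Pi.single ⟨0, ht⟩ 1 : Fin t → F) a :=
      fun a => congrFun hxe a
    have hx0 : x ≠ 0 := by
      rintro rfl
      simpa using hxa ⟨0, ht⟩
    refine ⟨x, hx, hx0, le_antisymm ?_ (hlow x hx hx0)⟩
    have hz : t - 1 ≤ (Finset.univ.filter fun i => x i = 0).card := by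
      calc t - 1 = ((Finset.univ.erase (⟨0, ht⟩ : Fin t)).map (Fin.castLEEmb htN)).card := by
            rw [Finset.card_map, Finset.card_erase_of_mem (Finset.mem_univ _)]
            simp
        _ ≤ _ := by
          refine Finset.card_le_card fun i hi => ?_
          obtain ⟨a, ha, rfl⟩ := Finset.mem_map.1 hi
          refine Finset.mem_filter.2 ⟨Finset.mem_univ _, ?_⟩
          exact (hxa a).trans (by simp [Finset.ne_of_mem_erase ha])
    have := hwt x
    omega
  · rintro w ⟨x, hx, hx0, rfl⟩
    exact hlow x hx hx0

/-- The coordinate functionals of a code. -/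
def Submodule.coordFunctional {F : Type*} [Field F] {n : ℕ}
    (C : Submodule F (Fin n → F)) (i : Fin n) : Module.Dual F C :=
  LinearMap.proj i ∘ₗ C.subtype

theorem linearIndependent_coordFunctional {F : Type*} [Field F] {n m : ℕ}
    {C : Submodule F (Fin n → F)} {T : Fin m → Fin n}
    (h : Function.Surjective (C.restrictCoords T)) :
    LinearIndependent F fun a => C.coordFunctional (T a) := by
  rw [Fintype.linearIndependent_iff]
  intro g hg a
  obtain ⟨z, hz⟩ := h (Pi.single a 1)
  have hza : ∀ b, C.coordFunctional (T b) z = (Pi.single a 1 : Fin m → F) b :=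
    fun b => congrFun hz b
  simpa [hza, Pi.single_apply] using LinearMap.congr_fun hg z

/-- If every full-support subcode of `C` has dimension larger than `dim C - m`, then any
`m`-dimensional space of functionals on `C` contains a coordinate functional. -/
theorem exists_coordFunctional_mem {F : Type*} [Field F] {n m : ℕ}
    {C : Submodule F (Fin n → F)} (hm : m < Module.finrank F C)
    (hγ : ∀ r ∈ gammaSet C, Module.finrank F C < r + m)
    (W : Submodule F (Module.Dual F C)) (hW : Module.finrank F W = m) :
    ∃ i, C.coordFunctional i ∈ W := by
  by_contra! hno
  have hdim : Module.finrank F W.dualCoannihilator = Module.finrank F C - m := by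
    have := Subspace.finrank_add_finrank_dualCoannihilator_eq W
    omega
  have := hγ (Module.finrank F C - m) ⟨by omega, W.dualCoannihilator.map C.subtype,
    Submodule.map_subtype_le _ _, ?_, fun i => ?_⟩
  · omega
  · rw [← hdim]
    exact Submodule.finrank_map_subtype_eq _ _
  · by_contra! hi
    apply hno i
    rw [← Subspace.dualCoannihilator_dualAnnihilator_eq (W := W), Submodule.mem_dualAnnihilator]
    intro z hz
    exact hi z ⟨z, hz, rfl⟩

/-- The hyperplane-covering step: inside the span of `m + 1` coordinate functionals, the
hyperplane `∑ a < m, x a = c * x m` contains a coordinate functional. -/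
theorem exists_coord_eq_sum {F : Type*} [Field F] {n m : ℕ} (hm0 : 0 < m)
    {C : Submodule F (Fin n → F)}
    (hγ : ∀ r ∈ gammaSet C, Module.finrank F C < r + m) {e : Fin (m + 1) → Fin n}
    (he : Function.Surjective (C.restrictCoords e)) (c : F) :
    ∃ (j : Fin n) (x : Fin (m + 1) → F), (∑ a : Fin m, x a.castSucc = c * x (Fin.last m)) ∧
      C.coordFunctional j = ∑ a, x a • C.coordFunctional (e a) := by
  have hli := linearIndependent_coordFunctional he
  have hm : m < Module.finrank F C := by
    have := hli.fintype_card_le_finrank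
    rw [Subspace.dual_finrank_eq] at this
    simpa using this
  let f : (Fin (m + 1) → F) →ₗ[F] F :=
    ∑ a : Fin m, LinearMap.proj a.castSucc - c • LinearMap.proj (Fin.last m)
  have hf : ∀ x, f x = ∑ a : Fin m, x a.castSucc - c * x (Fin.last m) := by
    intro x
    simp [f]
  have hfs : LinearMap.range f = ⊤ := by
    rw [LinearMap.range_eq_top]
    refine LinearMap.surjective fun h0 => ?_
    obtain ⟨i⟩ : Nonempty (Fin m) := ⟨⟨0, hm0⟩⟩
    have := hf (Pi.single i.castSucc 1)
    simp [h0, Pi.single_apply, (Fin.castSucc_ne_last i).symm] at this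
  have hker : Module.finrank F (LinearMap.ker f) = m := by
    have := f.finrank_range_add_finrank_ker
    rw [hfs] at this
    simp at this
    omega
  let φ := Fintype.linearCombination F fun a => C.coordFunctional (e a)
  have hφ : Function.Injective φ := linearIndependent_iff_injective_fintypeLinearCombination.1 hli
  obtain ⟨j, x, hx, hxj⟩ := exists_coordFunctional_mem hm hγ ((LinearMap.ker f).map φ)
    (by rw [← (Submodule.equivMapOfInjective φ hφ _).finrank_eq, hker])
  refine ⟨j, x, ?_, ?_⟩
  · exact sub_eq_zero.1 ((hf x).symm.trans hx)
  · rw [← hxj, Fintype.linearCombination_apply]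

/-- There are `q + m` coordinates of `C` whose functionals span a space of dimension `m + 1`. -/
theorem exists_coords_mem_span {F : Type*} [Field F] [Fintype F] [DecidableEq F] {n m : ℕ}
    (hm0 : 0 < m) (hmn : m + 1 ≤ n)
    {C : Submodule F (Fin n → F)} (hC : ∀ w ∈ dualWeights C, m + 1 < w)
    (hγ : ∀ r ∈ gammaSet C, Module.finrank F C < r + m) :
    ∃ (e : Fin (m + 1) → Fin n) (g : Fin (Fintype.card F + m) → Fin n),
      Function.Injective e ∧ Function.Injective g ∧ ∀ a, C.coordFunctional (g a) ∈
        Submodule.span F (Set.range fun b => C.coordFunctional (e b)) := by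
  let e : Fin (m + 1) → Fin n := Fin.castLE hmn
  have he : Function.Injective e := Fin.castLE_injective hmn
  have hs := restrictCoords_surjective hC he
  choose j x hx hj using exists_coord_eq_sum hm0 hγ hs
  have hz : ∀ u : Fin (m + 1) → F, ∃ z : C, (∀ a, z.1 (e a) = u a) ∧
      ∀ c, z.1 (j c) = ∑ a, x c a * u a := by
    intro u
    obtain ⟨z, hz⟩ := hs u
    have hz' : ∀ a, z.1 (e a) = u a := fun a => congrFun hz a
    refine ⟨z, hz', fun c => ?_⟩
    have : z.1 (j c) = ∑ a, x c a * z.1 (e a) := by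
      have := LinearMap.congr_fun (hj c) z
      simpa [Submodule.coordFunctional] using this
    simpa [hz'] using this
  have hlast : ∀ c, x c (Fin.last m) ≠ 0 := by
    intro c h0
    by_cases hr : ∃ a : Fin m, e a.castSucc = j c
    · obtain ⟨a, ha⟩ := hr
      obtain ⟨z, hze, hzj⟩ := hz 1
      have := hzj c
      rw [← ha, hze, Fin.sum_univ_castSucc] at this
      simp [hx, h0] at this
    · push Not at hr
      have hT : Function.Injective (Fin.snoc (fun a : Fin m => e a.castSucc) (j c) :
          Fin (m + 1) → Fin n) :=
        Fin.snoc_injective_iff.2 ⟨he.comp (Fin.castSucc_injective m), fun ⟨a, ha⟩ => hr a ha⟩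
      obtain ⟨z, hzT⟩ := restrictCoords_surjective hC hT (Pi.single (Fin.last m) 1)
      have hz1 : z.1 (j c) = 1 := by
        simpa [Submodule.restrictCoords, LinearMap.funLeft] using congrFun hzT (Fin.last m)
      have hz0 : ∀ a : Fin m, z.1 (e a.castSucc) = 0 := fun a => by
        simpa [Submodule.restrictCoords, LinearMap.funLeft] using congrFun hzT a.castSucc
      have := LinearMap.congr_fun (hj c) z
      rw [Fin.sum_univ_castSucc] at this
      simp [Submodule.coordFunctional, hz1, hz0, h0] at this
  have hjinj : Function.Injective j := by
    intro c c' hcc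
    have hxx : ∀ a, x c a = x c' a := by
      intro a
      obtain ⟨z, -, hzj⟩ := hz (Pi.single a 1)
      have := (hzj c).symm.trans ((congrArg z.1 hcc).trans (hzj c'))
      simpa [Pi.single_apply] using this
    have h1 := hx c
    simp only [hxx] at h1
    rw [hx c'] at h1
    exact (mul_right_cancel₀ (hlast c') h1).symm
  have hdisj : ∀ c (a : Fin m), j c ≠ e a.castSucc := by
    intro c a hca
    obtain ⟨z, hze, hzj⟩ := hz (Pi.single (Fin.last m) 1)
    have := (hzj c).symm.trans ((congrArg z.1 hca).trans (hze a.castSucc))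
    simp [Pi.single_apply] at this
    exact hlast c this
  let ι : Fin (Fintype.card F + m) ≃ F ⊕ Fin m :=
    finSumFinEquiv.symm.trans (Equiv.sumCongr (Fintype.equivFin F).symm (Equiv.refl _))
  let g : F ⊕ Fin m → Fin n := Sum.elim j fun a => e a.castSucc
  refine ⟨e, g ∘ ι, he, ?_, fun a => ?_⟩
  · exact (hjinj.sumElim (he.comp (Fin.castSucc_injective m)) hdisj).comp ι.injective
  · rw [Function.comp_apply]
    rcases ι a with c | b
    · simp only [g, Sum.elim_inl, hj]
      exact Submodule.sum_mem _ fun b _ =>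
        Submodule.smul_mem _ _ (Submodule.subset_span ⟨b, rfl⟩)
    · exact Submodule.subset_span ⟨b.castSucc, rfl⟩

/-- let `C` be an `[n,k]` code over `F_q` with `1 ≤ k < n` and
`d(C⊥) ≥ 4`, and set `t = d(C⊥) - 1`. If `γ(C) > k - d(C⊥) + 2` (i.e. every positive `r`
for which `C` has an `r`-dimensional full-support subcode satisfies `r > k - d(C⊥) + 2`),
then there exists an MDS code over `F_q` of length `q + t - 1` and dimension `t`
(hence of minimum Hamming weight `(q + t - 1) - t + 1 = q`). -/
theorem stmt14 {F : Type*} [Field F] [Fintype F] [DecidableEq F] {n k d : ℕ}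
    (C : Submodule F (Fin n → F)) (hCk : Module.finrank F C = k)
    (hk1 : 1 ≤ k) (hkn : k < n)
    (hd : IsLeast (dualWeights C) d) (hd4 : 4 ≤ d)
    (hγ : ∀ r ∈ gammaSet C, (k : ℤ) - (d : ℤ) + 2 < (r : ℤ)) :
    ∃ C' : Submodule F (Fin (Fintype.card F + (d - 1) - 1) → F),
      Module.finrank F C' = d - 1 ∧
      IsLeast {w : ℕ | ∃ x ∈ C', x ≠ 0 ∧ wt x = w}
        ((Fintype.card F + (d - 1) - 1) - (d - 1) + 1) := by
  obtain ⟨⟨y, -, -, hyd⟩, hmin⟩ := hd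
  have hdn : d ≤ n := by
    rw [← hyd]
    exact (Finset.card_le_univ _).trans (by simp)
  obtain ⟨m, rfl⟩ : ∃ m, d = m + 2 := ⟨d - 2, by omega⟩
  have hC : ∀ w ∈ dualWeights C, m + 1 < w := fun w hw => hmin hw
  obtain ⟨e, g, he, hg, hspan⟩ := exists_coords_mem_span (by omega) (by omega) hC
    fun r hr => by
      have := hγ r hr
      push_cast at this
      omega
  have hN : Fintype.card F + (m + 2 - 1) - 1 = Fintype.card F + m := by omega
  have hq : 0 < Fintype.card F := Fintype.card_pos
  rw [hN]
  refine ⟨C.map (LinearMap.funLeft F F g),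
    isLeast_weights_of_bijective (by omega) (by omega) fun T hT => ⟨?_, fun u => ?_⟩⟩
  · have hspan' : Submodule.span F (Set.range fun b => C.coordFunctional (g (T b))) =
        Submodule.span F (Set.range fun b => C.coordFunctional (e b)) := by
      refine Submodule.eq_of_le_of_finrank_eq (Submodule.span_le.2 ?_) ?_
      · rintro _ ⟨b, rfl⟩
        exact hspan _
      · rw [finrank_span_eq_card (linearIndependent_coordFunctional
            (T := fun b => g (T b))
            (restrictCoords_surjective hC (hg.comp hT))),
          finrank_span_eq_card (linearIndependent_coordFunctional
            (restrictCoords_surjective hC he))]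
        simp
    rw [← LinearMap.ker_eq_bot, LinearMap.ker_eq_bot']
    rintro ⟨_, z, hz, rfl⟩ h0
    have hle : Submodule.span F (Set.range fun b => C.coordFunctional (g (T b))) ≤
        LinearMap.ker (Module.Dual.eval F C ⟨z, hz⟩) := by
      rw [Submodule.span_le]
      rintro _ ⟨b, rfl⟩
      exact congrFun h0 b
    ext a
    exact hle (hspan' ▸ hspan a)
  · obtain ⟨z, hz⟩ := restrictCoords_surjective hC (hg.comp hT) u
    exact ⟨⟨_, z, z.2, rfl⟩, hz⟩
end
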